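/- Let q > 1 be an integer, let p be a prime divisor of q, and let n be any integer with 1 ≤ n ≤ q − 1. Then Σ_{s=0}^{p−1} e^{2πi(sq/p)/q}/(1 − e^{2πi n/q}) = 0, while |S(n, n, ..., n)| = n < q (with n repeated p times). In particular, the hypothesis 0 ≤ a_s < n_s cannot be dropped and the prime p cannot be replaced by a composite number in the statement that a nonempty system {a_s (mod n_s)}_{s=1}^k with Σ_{s=1}^k e^{2πi a_s/p}/(1 − e^{2πi n_s/p}) = 0 satisfies |S(n_1,...,n_k)| ≥ p. -/

import Mathlib

open Finset Complex
open scoped Classical Real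

/-- The exponentials at the multiples of `q / p`, taken modulo `q`, sum to zero. -/
theorem sum_exp_mul_div_eq_zero {p q : ℕ} (hp : 1 < p) (hq : q ≠ 0) :
    ∑ s ∈ range p,
      Complex.exp (2 * π * I * ((s : ℂ) * (q : ℂ) / (p : ℂ)) / (q : ℂ)) = 0 := by
  have hq' : (q : ℂ) ≠ 0 := Nat.cast_ne_zero.mpr hq
  rw [← (Complex.isPrimitiveRoot_exp p (by omega)).geom_sum_eq_zero hp]
  refine sum_congr rfl fun s _ => ?_
  rw [← Complex.exp_nat_mul]
  congr 1
  field_simp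

/-- The fractions `r / n` with `0 ≤ r < n` are distinct. -/
theorem card_image_range_div {n : ℕ} (hn : n ≠ 0) :
    ((range n).image fun r => (r : ℚ) / (n : ℚ)).card = n := by
  have hn' : (n : ℚ) ≠ 0 := Nat.cast_ne_zero.mpr hn
  have hcast : (do let a ← range n; pure (a : ℚ)) = (range n).image fun a : ℕ => (a : ℚ) := by
    ext x
    simp [eq_comm]
  rw [hcast, card_image_of_injective _ fun a b hab => (div_left_inj' hn').mp hab,
    card_image_of_injective _ Nat.cast_injective, card_range]

/-- **Example 1.1** (Pan–Sun). Let `q > 1` be an integer, `p` a prime divisor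
of `q`, and `1 ≤ n ≤ q − 1`.  Then
`∑_{s=0}^{p−1} e^{2πi(sq/p)/q}/(1 − e^{2πi n/q}) = 0`, while
`|S(n,…,n)| = n < q` (with `n` repeated `p` times).  Hence the hypothesis
`0 ≤ a_s < n_s` cannot be dropped, and the prime `p` cannot be replaced by a
composite number, in Corollary 1.2. -/
theorem example_composite
    (q : ℕ) (hq : 1 < q) (p : ℕ) (hp : p.Prime) (hpq : p ∣ q)
    (n : ℕ) (hn1 : 1 ≤ n) (hnq : n ≤ q - 1) :
    (∑ s ∈ range p,
        Complex.exp (2 * π * I * ((s : ℂ) * (q : ℂ) / (p : ℂ)) / (q : ℂ)) /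
          (1 - Complex.exp (2 * π * I * (n : ℂ) / (q : ℂ))) = 0) ∧
    (((univ : Finset (Fin p)).biUnion fun _ =>
        (range n).image fun r => (r : ℚ) / (n : ℚ)).card = n) ∧
    n < q := by
  refine ⟨?_, ?_, by omega⟩
  · rw [← sum_div, sum_exp_mul_div_eq_zero hp.one_lt (by omega), zero_div]
  · have : Nonempty (Fin p) := ⟨⟨0, hp.pos⟩⟩
    have hS : ((univ : Finset (Fin p)).biUnion fun _ =>
        (range n).image fun r => (r : ℚ) / (n : ℚ)) =
        (range n).image fun r => (r : ℚ) / (n : ℚ) := by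
      ext x
      simp
    rw [hS, card_image_range_div (by omega)]
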